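/- Let Λ be a finite alphabet and let X ⊆ Λ^ℕ be a subshift. Then the spectral partial action of 𝔽(Λ) on Ω_X is minimal (i.e., every orbit is dense in Ω_X) if and only if X is both collectively cofinal and strongly cofinal. -/

import Mathlib

open scoped Classical

namespace SubshiftPaper

variable {Λ : Type}

/-- The left shift on infinite words. -/
def shiftMap (x : ℕ → Λ) : ℕ → Λ := fun n => x (n + 1)

/-- Concatenation of a finite word with an infinite word. -/
def cat (α : List Λ) (y : ℕ → Λ) : ℕ → Λ := fun n => α.getD n (y (n - α.length))

/-- `α` is a prefix of the infinite word `x`. -/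
def Pref (α : List Λ) (x : ℕ → Λ) : Prop := ∀ (i : ℕ) (h : i < α.length), x i = α[i]

/-- The tail of `x` after `n` letters. -/
def tail (x : ℕ → Λ) (n : ℕ) : ℕ → Λ := fun i => x (n + i)

/-- `α` occurs in `x` at position `n`. -/
def OccursAt (α : List Λ) (x : ℕ → Λ) (n : ℕ) : Prop :=
  ∀ (i : ℕ) (h : i < α.length), x (n + i) = α[i]

/-- `α` occurs in `x` (as a contiguous block of letters). -/
def Occurs (α : List Λ) (x : ℕ → Λ) : Prop := ∃ n, OccursAt α x n

/-- `X` is a subshift: a nonempty closed shift-invariant subset. -/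
def IsSubshift [TopologicalSpace Λ] (X : Set (ℕ → Λ)) : Prop :=
  X.Nonempty ∧ IsClosed X ∧ ∀ x ∈ X, shiftMap x ∈ X

/-- The set of infinite words avoiding all words in `F`. -/
def ForbidSpace (F : Set (List Λ)) : Set (ℕ → Λ) := {x | ∀ α ∈ F, ¬ Occurs α x}

/-- `X` is a subshift of finite type. -/
def IsSFT (X : Set (ℕ → Λ)) : Prop := ∃ F : Set (List Λ), F.Finite ∧ X = ForbidSpace F

/-- The follower set of a finite word. -/
def follower (X : Set (ℕ → Λ)) (α : List Λ) : Set (ℕ → Λ) := {y | y ∈ X ∧ cat α y ∈ X}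

/-- The cylinder of a finite word. -/
def cylinder (X : Set (ℕ → Λ)) (α : List Λ) : Set (ℕ → Λ) := {x | x ∈ X ∧ Pref α x}

/-- The language of `X`. -/
def Language (X : Set (ℕ → Λ)) : Set (List Λ) := {α | ∃ x ∈ X, Occurs α x}

/-- The embedding of finite words into the free group. -/
def wd (α : List Λ) : FreeGroup Λ := (α.map FreeGroup.of).prod

/-- Indicator function of a set of group elements. -/
noncomputable def chi (s : Set (FreeGroup Λ)) : FreeGroup Λ → Bool :=
  fun g => if g ∈ s then true else false

/-- The set `ξ_x ⊆ 𝔽`. -/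
def xiSet [DecidableEq Λ] (X : Set (ℕ → Λ)) (x : ℕ → Λ) : Set (FreeGroup Λ) :=
  {g | ∃ α β : List Λ, g = wd α * (wd β)⁻¹ ∧
        FreeGroup.norm g = α.length + β.length ∧
        Pref α x ∧ tail x α.length ∈ follower X α ∩ follower X β}

/-- `ξ_x` as an element of `2^𝔽`. -/
noncomputable def xiB [DecidableEq Λ] (X : Set (ℕ → Λ)) (x : ℕ → Λ) : FreeGroup Λ → Bool :=
  chi (xiSet X x)

/-- The spectrum `Ω_X`: the closure of `{ξ_x : x ∈ X}` in `2^𝔽`. -/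
noncomputable def Omega [DecidableEq Λ] (X : Set (ℕ → Λ)) : Set (FreeGroup Λ → Bool) :=
  closure ((fun x => xiB X x) '' X)

/-- Left translation of an element of `2^𝔽`. -/
def translate (g : FreeGroup Λ) (ξ : FreeGroup Λ → Bool) : FreeGroup Λ → Bool :=
  fun h => ξ (g⁻¹ * h)

/-- `x` is the stem of `ξ`: `ξ ∩ 𝔽₊` is exactly the set of prefixes of `x`. -/
def IsStem (ξ : FreeGroup Λ → Bool) (x : ℕ → Λ) : Prop :=
  {g | ξ g = true} ∩ {g | ∃ α : List Λ, g = wd α} =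
    {g | ∃ α : List Λ, g = wd α ∧ Pref α x}

/-- `x` is the stem of `ξ` at `g`: `ξ ∩ g𝔽₊ = {gα : α is a prefix of x}`. -/
def IsStemAt (ξ : FreeGroup Λ → Bool) (g : FreeGroup Λ) (x : ℕ → Λ) : Prop :=
  {h | ξ h = true} ∩ {h | ∃ α : List Λ, h = g * wd α} =
    {h | ∃ α : List Λ, h = g * wd α ∧ Pref α x}

/-- The orbit of `ξ` under the spectral partial action. -/
def Orbit (ξ : FreeGroup Λ → Bool) : Set (FreeGroup Λ → Bool) :=
  {η | ∃ g : FreeGroup Λ, ξ g⁻¹ = true ∧ η = translate g ξ}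

/-- Topological freeness of the spectral partial action. -/
noncomputable def TopFree [DecidableEq Λ] (X : Set (ℕ → Λ)) : Prop :=
  ∀ g : FreeGroup Λ, g ≠ 1 →
    ∀ U : Set (FreeGroup Λ → Bool), IsOpen U →
      (U ∩ Omega X ⊆ {ξ | ξ g⁻¹ = true ∧ translate g ξ = ξ}) → U ∩ Omega X = ∅

/-- The periodic infinite word `γ^∞`. -/
noncomputable def perInf [Nonempty Λ] (γ : List Λ) : ℕ → Λ :=
  fun n => γ.getD (n % γ.length) (Classical.arbitrary Λ)

/-- `n`-fold concatenation of a finite word with itself. -/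
def rep : ℕ → List Λ → List Λ
  | 0, _ => []
  | n + 1, γ => γ ++ rep n γ

/-- `γ` is a circuit relative to `X`. -/
noncomputable def IsCircuit [Nonempty Λ] (X : Set (ℕ → Λ)) (γ : List Λ) : Prop :=
  γ ≠ [] ∧ perInf γ ∈ X

/-- `y` is an exit for the circuit `γ`. -/
noncomputable def IsExit [Nonempty Λ] (X : Set (ℕ → Λ)) (γ : List Λ) (y : ℕ → Λ) : Prop :=
  y ≠ perInf γ ∧ cat γ y ∈ X

/-- `z` is a strong exit for the circuit `γ`. -/
noncomputable def IsStrongExit [Nonempty Λ] (X : Set (ℕ → Λ)) (γ : List Λ) (z : ℕ → Λ) : Prop :=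
  z ≠ perInf γ ∧ ∀ n : ℕ, cat (rep n γ) z ∈ X

/-- The sets `X_g` of the standard partial action. -/
def Xg [DecidableEq Λ] (X : Set (ℕ → Λ)) (g : FreeGroup Λ) : Set (ℕ → Λ) :=
  {x | ∃ α β : List Λ, g = wd α * (wd β)⁻¹ ∧
        FreeGroup.norm g = α.length + β.length ∧
        ∃ y ∈ follower X α ∩ follower X β, x = cat α y}

/-- `x` is a fixed point for `θ_g`. -/
def IsThetaFixed [DecidableEq Λ] (X : Set (ℕ → Λ)) (g : FreeGroup Λ) (x : ℕ → Λ) : Prop :=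
  ∃ α β : List Λ, g = wd α * (wd β)⁻¹ ∧
    FreeGroup.norm g = α.length + β.length ∧
    ∃ y ∈ follower X α ∩ follower X β, x = cat β y ∧ cat α y = x

/-- `x` may be collectively reached from the finite set `B`. -/
def CollReached (X : Set (ℕ → Λ)) (B : Finset (List Λ)) (x : ℕ → Λ) : Prop :=
  ∃ α γ : List Λ, Pref α x ∧ ∀ β ∈ B, cat (β ++ γ) (tail x α.length) ∈ X

/-- `X` is collectively cofinal. -/
def CollCofinal (X : Set (ℕ → Λ)) : Prop :=
  ∀ B : Finset (List Λ), ↑B ⊆ Language X → (⋂ β ∈ B, follower X β).Nonempty →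
    ∀ x ∈ X, CollReached X B x

/-- `X` is strongly cofinal. -/
def StrongCofinal (X : Set (ℕ → Λ)) : Prop :=
  ∀ β ∈ Language X, ∃ M : ℕ, ∀ x ∈ X, ∃ α γ : List Λ, Pref α x ∧
    cat (β ++ γ) (tail x α.length) ∈ X ∧ α.length + γ.length ≤ M

/-- The even shift. -/
def evenShift : Set (ℕ → Fin 2) :=
  ForbidSpace {w | ∃ n : ℕ, w = 0 :: (List.replicate (2 * n + 1) 1 ++ [0])}


section aux
variable {Λ : Type}

lemma cat_append (a b : List Λ) (y : ℕ → Λ) : cat (a ++ b) y = cat a (cat b y) := by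
  funext n
  unfold cat
  by_cases h : n < a.length
  · rw [List.getD_append _ _ _ _ h]
    simp [h]
  · push Not at h
    rw [List.getD_append_right _ _ _ _ h, List.getD_eq_default _ _ h]
    congr 2
    simp; omega

lemma cat_nil (y : ℕ → Λ) : cat [] y = y := by
  funext n; simp [cat]

lemma cat_apply_lt (a : List Λ) (y : ℕ → Λ) (i : ℕ) (h : i < a.length) : cat a y i = a[i] := by
  simp [cat, h]

lemma cat_apply_add (a : List Λ) (y : ℕ → Λ) (i : ℕ) : cat a y (a.length + i) = y i := by
  simp [cat]

lemma pref_cat (a : List Λ) (y : ℕ → Λ) : Pref a (cat a y) := fun i h => cat_apply_lt a y i h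

lemma tail_cat (a : List Λ) (y : ℕ → Λ) : tail (cat a y) a.length = y := by
  funext i; exact cat_apply_add a y i

lemma cat_tail {a : List Λ} {x : ℕ → Λ} (h : Pref a x) : cat a (tail x a.length) = x := by
  funext n
  by_cases hn : n < a.length
  · rw [cat_apply_lt _ _ _ hn, h n hn]
  · obtain ⟨k, rfl⟩ := Nat.exists_eq_add_of_le (not_lt.1 hn)
    rw [cat_apply_add]; rfl

lemma tail_mem [TopologicalSpace Λ] {X : Set (ℕ → Λ)} (hX : IsSubshift X) {x : ℕ → Λ}
    (hx : x ∈ X) (n : ℕ) : tail x n ∈ X := by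
  induction n with
  | zero => convert hx using 1; funext i; simp [tail]
  | succ n ih =>
    convert hX.2.2 _ ih using 1
    funext i; simp only [tail, shiftMap]; congr 1; omega

lemma of_cat_mem [TopologicalSpace Λ] {X : Set (ℕ → Λ)} (hX : IsSubshift X) {a : List Λ}
    {y : ℕ → Λ} (h : cat a y ∈ X) : y ∈ X := by
  have := tail_mem hX h a.length
  rwa [tail_cat] at this

/-- The prefix of length `n`. -/
def pre (x : ℕ → Λ) (n : ℕ) : List Λ := List.ofFn (fun i : Fin n => x i)

lemma pre_length (x : ℕ → Λ) (n : ℕ) : (pre x n).length = n := by simp [pre]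

lemma pref_pre (x : ℕ → Λ) (n : ℕ) : Pref (pre x n) x := by
  intro i h; simp [pre]

lemma pref_pre_iff (x z : ℕ → Λ) (n : ℕ) : Pref (pre x n) z ↔ ∀ i < n, z i = x i := by
  constructor
  · intro h i hi
    have := h i (by rwa [pre_length])
    simpa only [pre, List.getElem_ofFn] using this
  · intro h i hi
    rw [pre_length] at hi
    simpa only [pre, List.getElem_ofFn] using h i hi

lemma cat_pre (x : ℕ → Λ) (n : ℕ) : cat (pre x n) (tail x n) = x := by
  have := cat_tail (pref_pre x n)
  rwa [pre_length] at this

lemma wd_append (a b : List Λ) : wd (a ++ b) = wd a * wd b := by simp [wd]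
lemma wd_nil : wd ([] : List Λ) = 1 := by simp [wd]

lemma wd_eq_mk (a : List Λ) : wd a = FreeGroup.mk (a.map (fun l => (l, true))) := by
  induction a with
  | nil => simp [wd, FreeGroup.one_eq_mk]
  | cons c a ih =>
    have : wd (c :: a) = FreeGroup.of c * wd a := by simp [wd]
    rw [this, ih, FreeGroup.of, FreeGroup.mul_mk]; simp

lemma isChain_of_all {α : Type*} {R : α → α → Prop} (l : List α) (h : ∀ a b, R a b) :
    l.IsChain R := by
  rw [List.isChain_iff_getElem]
  exact fun _ _ => h _ _

lemma isReduced_map (a : List Λ) : FreeGroup.IsReduced (a.map (fun l => (l, true))) := by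
  unfold FreeGroup.IsReduced
  rw [List.isChain_map]
  exact isChain_of_all _ (by simp)

lemma wd_injective [DecidableEq Λ] {a b : List Λ} (h : wd a = wd b) : a = b := by
  rw [wd_eq_mk, wd_eq_mk] at h
  have := congrArg FreeGroup.toWord h
  rw [FreeGroup.toWord_mk, FreeGroup.toWord_mk, (isReduced_map a).reduce_eq,
    (isReduced_map b).reduce_eq] at this
  exact List.map_injective_iff.2 (fun x y hxy => by simpa using hxy) this

lemma norm_wd [DecidableEq Λ] (a b : List Λ) :
    (∃ c a' b', a = a' ++ [c] ∧ b = b' ++ [c]) ∨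
    FreeGroup.norm (wd a * (wd b)⁻¹) = a.length + b.length := by
  by_cases h : ∃ c a' b', a = a' ++ [c] ∧ b = b' ++ [c]
  · exact Or.inl h
  right
  rw [wd_eq_mk, wd_eq_mk, FreeGroup.inv_mk, FreeGroup.mul_mk]
  have hr : FreeGroup.IsReduced
      (a.map (fun l => (l, true)) ++ FreeGroup.invRev (b.map (fun l => (l, true)))) := by
    unfold FreeGroup.IsReduced
    rw [List.isChain_append]
    refine ⟨?_, ?_, ?_⟩
    · exact isReduced_map a
    · simp only [FreeGroup.invRev, List.map_map, List.isChain_reverse, List.isChain_map]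
      exact isChain_of_all _ (by simp)
    · intro p hp q hq hpq
      simp [FreeGroup.invRev] at hp hq
      obtain ⟨c, hc, rfl⟩ := hp
      obtain ⟨d, hd, rfl⟩ := hq
      simp at hpq
      subst hpq
      exfalso; apply h
      rw [List.getLast?_eq_some_iff] at hc hd
      obtain ⟨a', rfl⟩ := hc
      obtain ⟨b', rfl⟩ := hd
      exact ⟨_, _, _, rfl, rfl⟩
  rw [FreeGroup.norm, FreeGroup.toWord_mk, FreeGroup.IsReduced.reduce_eq hr]
  simp

lemma exists_reduced [DecidableEq Λ] (n : ℕ) : ∀ a b : List Λ, a.length = n →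
    ∃ a' b' c, a = a' ++ c ∧ b = b' ++ c ∧
      FreeGroup.norm (wd a' * (wd b')⁻¹) = a'.length + b'.length := by
  induction n with
  | zero =>
    intro a b h
    rcases norm_wd a b with ⟨c, a', b', rfl, rfl⟩ | h1
    · simp at h
    · exact ⟨a, b, [], by simp, by simp, h1⟩
  | succ n ih =>
    intro a b h
    rcases norm_wd a b with ⟨c, a', b', rfl, rfl⟩ | h1
    · obtain ⟨a1, b1, c1, rfl, rfl, h2⟩ := ih a' b' (by simpa using h)
      exact ⟨a1, b1, c1 ++ [c], by simp, by simp, h2⟩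
    · exact ⟨a, b, [], by simp, by simp, h1⟩

lemma mem_xi [TopologicalSpace Λ] [DecidableEq Λ] {X : Set (ℕ → Λ)} (hX : IsSubshift X)
    {x : ℕ → Λ} (hx : x ∈ X) (g : FreeGroup Λ) :
    g ∈ xiSet X x ↔ ∃ a b z, g = wd a * (wd b)⁻¹ ∧ x = cat a z ∧ cat b z ∈ X := by
  constructor
  · rintro ⟨a, b, rfl, -, hp, h1, h2⟩
    exact ⟨a, b, tail x a.length, rfl, (cat_tail hp).symm, h2.2⟩
  · rintro ⟨a, b, z, rfl, rfl, hb⟩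
    obtain ⟨a', b', c, rfl, rfl, hn⟩ := exists_reduced _ a b rfl
    rw [cat_append] at hx hb
    have e : wd (a' ++ c) * (wd (b' ++ c))⁻¹ = wd a' * (wd b')⁻¹ := by
      simp only [wd_append]; group
    rw [e, cat_append]
    refine ⟨a', b', rfl, hn, pref_cat _ _, ?_⟩
    rw [tail_cat]
    exact ⟨⟨of_cat_mem hX hx, hx⟩, ⟨of_cat_mem hX hx, hb⟩⟩

/-- Common prefix comparison. -/
lemma cat_eq_cat {a b : List Λ} {y z : ℕ → Λ} (h : cat a y = cat b z)
    (hl : a.length ≤ b.length) : ∃ c, b = a ++ c ∧ y = cat c z := by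
  have hb : b = a ++ b.drop a.length := by
    conv_lhs => rw [← List.take_append_drop a.length b]
    congr 1
    apply List.ext_getElem
    · simpa using hl
    · intro i h1 h2
      have := congrFun h i
      rw [cat_apply_lt _ _ _ h2, cat_apply_lt _ _ _ (by omega)] at this
      simp [this]
  refine ⟨_, hb, ?_⟩
  rw [hb, cat_append] at h
  have := congrArg (fun w => tail w a.length) h
  simpa only [tail_cat] using this

lemma translate_mem [TopologicalSpace Λ] [DecidableEq Λ] {X : Set (ℕ → Λ)} (hX : IsSubshift X)
    {a b : List Λ} {z : ℕ → Λ} (ha : cat a z ∈ X) (hb : cat b z ∈ X) {h : FreeGroup Λ}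
    (hh : h ∈ xiSet X (cat a z)) : wd b * (wd a)⁻¹ * h ∈ xiSet X (cat b z) := by
  rw [mem_xi hX ha] at hh
  obtain ⟨m, n, w, rfl, hw, hn⟩ := hh
  rw [mem_xi hX hb]
  rcases le_total a.length m.length with hl | hl
  · obtain ⟨c, rfl, rfl⟩ := cat_eq_cat hw hl
    refine ⟨b ++ c, n, w, ?_, (cat_append _ _ _).symm, hn⟩
    simp only [wd_append]; group
  · obtain ⟨c, rfl, rfl⟩ := cat_eq_cat hw.symm hl
    refine ⟨b, n ++ c, z, ?_, rfl, by rwa [cat_append]⟩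
    simp only [wd_append]; group

lemma translate_mem_iff [TopologicalSpace Λ] [DecidableEq Λ] {X : Set (ℕ → Λ)}
    (hX : IsSubshift X)
    {a b : List Λ} {z : ℕ → Λ} (ha : cat a z ∈ X) (hb : cat b z ∈ X) (h : FreeGroup Λ) :
    wd a * (wd b)⁻¹ * h ∈ xiSet X (cat a z) ↔ h ∈ xiSet X (cat b z) := by
  refine ⟨fun H => ?_, fun H => translate_mem hX hb ha H⟩
  have := translate_mem hX ha hb H
  convert this using 1; group

lemma xiB_true [DecidableEq Λ] (X : Set (ℕ → Λ)) (x : ℕ → Λ) (g : FreeGroup Λ) :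
    xiB X x g = true ↔ g ∈ xiSet X x := by simp [xiB, chi]

lemma continuous_cat [TopologicalSpace Λ] (a : List Λ) : Continuous (cat a) := by
  refine continuous_pi fun n => ?_
  by_cases h : n < a.length
  · simp only [cat, List.getD_eq_getElem _ _ h]; exact continuous_const
  · simp only [cat, List.getD_eq_default _ _ (not_lt.1 h)]; exact continuous_apply _

lemma continuous_tail [TopologicalSpace Λ] (n : ℕ) : Continuous (fun x : ℕ → Λ => tail x n) :=
  continuous_pi fun _ => continuous_apply _

lemma open_nhd [TopologicalSpace Λ] {U : Set (ℕ → Λ)} (hU : IsOpen U) {x : ℕ → Λ} (hx : x ∈ U) :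
    ∃ N, ∀ z, Pref (pre x N) z → z ∈ U := by
  obtain ⟨I, u, h1, h2⟩ := isOpen_pi_iff.1 hU x hx
  refine ⟨I.sup id + 1, fun z hz => h2 fun i hi => ?_⟩
  have : i < I.sup id + 1 := Nat.lt_succ_of_le (Finset.le_sup (f := id) hi)
  rw [(pref_pre_iff _ _ _).1 hz i this]; exact (h1 i hi).2

lemma isClosed_pref [TopologicalSpace Λ] [DiscreteTopology Λ] (a : List Λ) :
    IsClosed {x : ℕ → Λ | Pref a x} := by
  simp only [Pref, Set.ofPred_forall]
  refine isClosed_iInter fun i => isClosed_iInter fun h => ?_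
  exact isClosed_eq (continuous_apply i) continuous_const

/-- Words of length at most `n` form a finite set. -/
lemma finite_words [Fintype Λ] (n : ℕ) : {a : List Λ | a.length ≤ n}.Finite :=
  List.finite_length_le Λ n

lemma isClosed_xi [Fintype Λ] [TopologicalSpace Λ] [DiscreteTopology Λ] [DecidableEq Λ]
    {X : Set (ℕ → Λ)} (hX : IsSubshift X) (h : FreeGroup Λ) :
    IsClosed {x : ℕ → Λ | h ∈ xiSet X x} := by
  have hf := (finite_words (Λ := Λ) (FreeGroup.norm h)).prod
    (finite_words (Λ := Λ) (FreeGroup.norm h))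
  have : {x : ℕ → Λ | h ∈ xiSet X x} = ⋃ p ∈ ({a : List Λ | a.length ≤ FreeGroup.norm h} ×ˢ
      {a : List Λ | a.length ≤ FreeGroup.norm h}),
      {x | h = wd p.1 * (wd p.2)⁻¹ ∧ FreeGroup.norm h = p.1.length + p.2.length ∧
        Pref p.1 x ∧ tail x p.1.length ∈ follower X p.1 ∩ follower X p.2} := by
    ext x
    simp only [Set.mem_iUnion, Set.mem_ofPred_eq]
    constructor
    · rintro ⟨a, b, h1, h2, h3⟩
      exact ⟨(a, b), ⟨by simp; omega, by simp; omega⟩, h1, h2, h3⟩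
    · rintro ⟨⟨a, b⟩, -, h1, h2, h3⟩
      exact ⟨a, b, h1, h2, h3⟩
  rw [this]
  refine hf.isClosed_biUnion fun p _ => ?_
  have hc : ∀ b : List Λ, IsClosed (follower X b) := fun b =>
    hX.2.1.inter (hX.2.1.preimage (continuous_cat b))
  refine isClosed_const.and (isClosed_const.and ((isClosed_pref p.1).and ?_))
  exact ((hc p.1).inter (hc p.2)).preimage (continuous_tail p.1.length)


lemma inv_mem [TopologicalSpace Λ] [DecidableEq Λ] {X : Set (ℕ → Λ)} (hX : IsSubshift X)
    {y : ℕ → Λ} (hy : y ∈ X) (b : List Λ) : (wd b)⁻¹ ∈ xiSet X y ↔ cat b y ∈ X := by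
  rw [mem_xi hX hy]
  constructor
  · rintro ⟨m, n, w, h, rfl, hn⟩
    have h1 : wd n = wd (b ++ m) := by
      rw [wd_append]
      have : wd m = (wd b)⁻¹ * wd n := by rw [h]; group
      rw [this]; group
    rw [wd_injective h1, cat_append] at hn
    exact hn
  · intro h
    exact ⟨[], b, y, by simp [wd_nil], (cat_nil y).symm, h⟩

lemma reach [TopologicalSpace Λ] [DecidableEq Λ] {X : Set (ℕ → Λ)} (hX : IsSubshift X)
    {x : ℕ → Λ} (hx : x ∈ X) {u : FreeGroup Λ} (hu : u ∈ xiSet X x) :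
    ∃ a c : List Λ, Pref a x ∧ a.length + c.length = FreeGroup.norm u ∧
      ∀ b, u * (wd b)⁻¹ ∈ xiSet X x → cat (b ++ c) (tail x a.length) ∈ X := by
  obtain ⟨a, c, rfl, hn, hp, h1, h2⟩ := hu
  refine ⟨a, c, hp, hn.symm, fun b hb => ?_⟩
  have e := cat_tail hp
  have := translate_mem_iff hX h1.2 h2.2 (wd b)⁻¹
  rw [e] at this
  rw [cat_append, ← inv_mem hX h2.2]
  exact this.1 hb

lemma mem_lang {X : Set (ℕ → Λ)} {b : List Λ} {z : ℕ → Λ} (h : cat b z ∈ X) : b ∈ Language X :=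
  ⟨_, h, 0, fun i hi => by rw [Nat.zero_add]; exact pref_cat b z i hi⟩

lemma lang_cat [TopologicalSpace Λ] {X : Set (ℕ → Λ)} (hX : IsSubshift X) {b : List Λ}
    (h : b ∈ Language X) : ∃ z, cat b z ∈ X := by
  obtain ⟨x, hx, n, hn⟩ := h
  refine ⟨tail (tail x n) b.length, ?_⟩
  rw [cat_tail (show Pref b (tail x n) from fun i hi => hn i hi)]
  exact tail_mem hX hx n

/-- Collective cofinality together with strong cofinality gives uniform collective reaching. -/
lemma coll_uniform [Fintype Λ] [TopologicalSpace Λ] [DiscreteTopology Λ]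
    {X : Set (ℕ → Λ)} (hX : IsSubshift X) (h1 : CollCofinal X) (h2 : StrongCofinal X)
    (B : Finset (List Λ)) (hB : ↑B ⊆ Language X) (hF : (⋂ β ∈ B, follower X β).Nonempty) :
    ∃ P : Set (List Λ × List Λ), P.Finite ∧ ∀ x ∈ X, ∃ p ∈ P, ∃ z, x = cat p.1 z ∧
      ∀ b ∈ B, cat (b ++ p.2) z ∈ X := by
  have : CompactSpace X := isCompact_iff_compactSpace.1 hX.2.1.isCompact
  have : Nonempty X := hX.1.to_subtype
  let f : List Λ × List Λ → Set X := fun p =>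
    {x | Pref p.1 x.1 ∧ ∀ b ∈ B, cat (b ++ p.2) (tail x.1 p.1.length) ∈ X}
  have hc : ∀ p, IsClosed (f p) := by
    intro p
    refine IsClosed.and ((isClosed_pref p.1).preimage continuous_subtype_val) ?_
    simp only [Set.ofPred_forall]
    refine isClosed_iInter fun b => isClosed_iInter fun _ => ?_
    exact hX.2.1.preimage ((continuous_cat _).comp
      ((continuous_tail _).comp continuous_subtype_val))
  have hU : ⋃ p, f p = Set.univ := by
    refine Set.eq_univ_of_forall fun x => ?_
    obtain ⟨a, c, h⟩ := h1 B hB hF x.1 x.2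
    exact Set.mem_iUnion.2 ⟨(a, c), h⟩
  obtain ⟨⟨a, c⟩, ⟨x0, hx0⟩, hi⟩ := nonempty_interior_of_iUnion_of_closed hc hU
  obtain ⟨U, hUf, hUo, hxU⟩ := mem_interior.1 hi
  obtain ⟨V, hV, rfl⟩ := isOpen_induced_iff.1 hUo
  obtain ⟨N, hN⟩ := open_nhd hV hxU
  have hpa : Pref a x0 := (hUf hxU).1
  obtain ⟨c', hc', -⟩ := cat_eq_cat ((cat_tail hpa).trans (cat_pre x0 (max N a.length)).symm)
    (by rw [pre_length]; exact le_max_right _ _)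
  obtain ⟨M, hM⟩ := h2 (pre x0 (max N a.length))
    (mem_lang (z := tail x0 (max N a.length)) (by rwa [cat_pre]))
  refine ⟨(fun p : List Λ × List Λ => (p.1, c ++ (c' ++ p.2))) ''
    ({a : List Λ | a.length ≤ M} ×ˢ {a : List Λ | a.length ≤ M}),
    ((finite_words M).prod (finite_words M)).image _, fun x hx => ?_⟩
  obtain ⟨a1, c1, hp1, hm1, hl⟩ := hM x hx
  refine ⟨_, ⟨(a1, c1), ⟨by simp; omega, by simp; omega⟩, rfl⟩, tail x a1.length,
    (cat_tail hp1).symm, fun b hb => ?_⟩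
  have hw : Pref (pre x0 N) (cat (pre x0 (max N a.length) ++ c1) (tail x a1.length)) := by
    rw [pref_pre_iff, cat_append]
    intro i hi
    exact (pref_pre_iff _ _ _).1 (pref_cat _ _) i (lt_of_lt_of_le hi (le_max_left _ _))
  have h3 := (hUf (a := ⟨_, hm1⟩) (hN _ hw)).2 b hb
  simp only [hc', List.append_assoc] at h3
  rw [cat_append a, tail_cat, ← cat_append] at h3
  simpa using h3

lemma local_agree [Fintype Λ] [TopologicalSpace Λ] [DiscreteTopology Λ] [DecidableEq Λ]
    {X : Set (ℕ → Λ)} (hX : IsSubshift X) {y : ℕ → Λ} (hy : y ∈ X) (h : FreeGroup Λ) :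
    ∃ N0, ∀ N, N0 ≤ N → ∃ B : Finset (List Λ), (∀ b ∈ B, cat b (tail y N) ∈ X) ∧
      ∀ z, cat (pre y N) z ∈ X → (∀ b ∈ B, cat b z ∈ X) →
        (h ∈ xiSet X (cat (pre y N) z) ↔ h ∈ xiSet X y) := by
  by_cases hh : h ∈ xiSet X y
  · obtain ⟨a, b, w, rfl, rfl, hb⟩ := (mem_xi hX hy _).1 hh
    refine ⟨a.length, fun N hN => ?_⟩
    obtain ⟨c, hc, hw⟩ := cat_eq_cat (cat_pre (cat a w) N).symm (by rwa [pre_length])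
    refine ⟨{b ++ c}, ?_, ?_⟩
    · intro b' hb'
      rw [Finset.mem_singleton] at hb'
      subst hb'
      rw [cat_append, ← hw]; exact hb
    · intro z hz hB
      simp only [hh, iff_true]
      rw [mem_xi hX hz]
      refine ⟨a, b, cat c z, rfl, by rw [hc, cat_append], ?_⟩
      rw [← cat_append]; exact hB _ (Finset.mem_singleton_self _)
  · obtain ⟨N0, hN0⟩ := open_nhd (isClosed_xi hX h).isOpen_compl (x := y) hh
    refine ⟨N0, fun N hN => ⟨∅, by simp, fun z _ _ => ?_⟩⟩
    simp only [hh, iff_false]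
    refine hN0 _ ?_
    rw [pref_pre_iff]
    intro i hi
    exact (pref_pre_iff _ _ _).1 (pref_cat _ _) i (lt_of_lt_of_le hi hN)

lemma key [Fintype Λ] [TopologicalSpace Λ] [DiscreteTopology Λ] [DecidableEq Λ]
    {X : Set (ℕ → Λ)} (hX : IsSubshift X) (h1 : CollCofinal X) (h2 : StrongCofinal X)
    {y : ℕ → Λ} (hy : y ∈ X) (E : Finset (FreeGroup Λ)) :
    ∃ G : Set (FreeGroup Λ), G.Finite ∧ ∀ x ∈ X, ∃ g ∈ G, g⁻¹ ∈ xiSet X x ∧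
      ∀ h ∈ E, (g⁻¹ * h ∈ xiSet X x ↔ h ∈ xiSet X y) := by
  choose N0 hN0 using local_agree hX hy
  have hle : ∀ h ∈ E, N0 h ≤ E.sup N0 := fun h hh => Finset.le_sup hh
  generalize E.sup N0 = N at hle
  have hex : ∀ h, ∃ B : Finset (List Λ), h ∈ E → (∀ b ∈ B, cat b (tail y N) ∈ X) ∧
      ∀ z, cat (pre y N) z ∈ X → (∀ b ∈ B, cat b z ∈ X) →
        (h ∈ xiSet X (cat (pre y N) z) ↔ h ∈ xiSet X y) := by
    intro h
    by_cases hh : h ∈ E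
    · obtain ⟨B, hB⟩ := hN0 h N (hle h hh)
      exact ⟨B, fun _ => hB⟩
    · exact ⟨∅, fun h' => absurd h' hh⟩
  choose B hB using hex
  have hall : ∀ b ∈ insert (pre y N) (E.biUnion B), cat b (tail y N) ∈ X := by
    intro b hb
    rw [Finset.mem_insert, Finset.mem_biUnion] at hb
    rcases hb with rfl | ⟨h, hh, hb⟩
    · rwa [cat_pre]
    · exact (hB h hh).1 b hb
  obtain ⟨P, hP, hPx⟩ := coll_uniform hX h1 h2 (insert (pre y N) (E.biUnion B))
    (fun b hb => mem_lang (hall b hb))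
    ⟨tail y N, Set.mem_iInter₂.2 fun b hb => ⟨tail_mem hX hy N, hall b hb⟩⟩
  refine ⟨_, hP.image (fun p => wd (pre y N ++ p.2) * (wd p.1)⁻¹), fun x hx => ?_⟩
  obtain ⟨⟨a, c⟩, hp, z, rfl, hz⟩ := hPx x hx
  refine ⟨_, ⟨_, hp, rfl⟩, ?_, ?_⟩
  · rw [mem_xi hX hx]
    exact ⟨a, pre y N ++ c, z, by group, rfl, hz _ (Finset.mem_insert_self _ _)⟩
  · intro h hh
    have hd := hz _ (Finset.mem_insert_self _ _)
    have e : (wd (pre y N ++ c) * (wd a)⁻¹)⁻¹ = wd a * (wd (pre y N ++ c))⁻¹ := by group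
    simp only [e]
    rw [translate_mem_iff hX hx hd, cat_append]
    rw [cat_append] at hd
    refine (hB h hh).2 _ hd fun b hb => ?_
    rw [← cat_append]
    exact hz b (Finset.mem_insert_of_mem (Finset.mem_biUnion.2 ⟨h, hh, hb⟩))

lemma isClopen_coord (g : FreeGroup Λ) (v : Bool) :
    IsClopen {ξ : FreeGroup Λ → Bool | ξ g = v} :=
  (isClopen_discrete {v}).preimage (continuous_apply g)

lemma xi_mem_Omega [DecidableEq Λ] {X : Set (ℕ → Λ)} {x : ℕ → Λ} (hx : x ∈ X) :
    xiB X x ∈ Omega X := subset_closure ⟨x, hx, rfl⟩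

end aux

/-- the spectral partial action is minimal iff `X` is both collectively
cofinal and strongly cofinal. -/
theorem minimal_iff {Λ : Type} [Fintype Λ] [Nonempty Λ] [DecidableEq Λ]
    [TopologicalSpace Λ] [DiscreteTopology Λ]
    (X : Set (ℕ → Λ)) (hX : IsSubshift X) :
    (∀ ξ ∈ Omega X, Omega X ⊆ closure (Orbit ξ)) ↔
      (CollCofinal X ∧ StrongCofinal X) := by
  constructor
  · intro hmin
    constructor
    · intro B _ ⟨y, hy⟩ x hx
      by_cases hne : B.Nonempty
      swap
      · rw [Finset.not_nonempty_iff_eq_empty] at hne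
        subst hne
        exact ⟨[], [], fun i hi => absurd hi (by simp), by simp⟩
      rw [Set.mem_iInter₂] at hy
      obtain ⟨b0, hb0⟩ := hne
      have hyX : y ∈ X := (hy b0 hb0).1
      have hU : IsOpen (⋂ b ∈ B, {ξ : FreeGroup Λ → Bool | ξ (wd b)⁻¹ = true}) :=
        isOpen_biInter_finset fun b _ => (isClopen_coord _ _).isOpen
      obtain ⟨η, h1, g, hg, rfl⟩ := mem_closure_iff.1
        (hmin _ (xi_mem_Omega hx) (xi_mem_Omega hyX)) _ hU
        (Set.mem_iInter₂.2 fun b hb => (xiB_true _ _ _).2 ((inv_mem hX hyX b).2 (hy b hb).2))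
      rw [xiB_true] at hg
      obtain ⟨a, c, hp, -, h⟩ := reach hX hx hg
      refine ⟨a, c, hp, fun b hb => h b ?_⟩
      exact (xiB_true _ _ _).1 (Set.mem_iInter₂.1 h1 b hb)
    · intro b hb
      obtain ⟨y, hy⟩ := lang_cat hX hb
      have hyX := of_cat_mem hX hy
      let V : FreeGroup Λ → Set (FreeGroup Λ → Bool) := fun g =>
        {ξ | ξ g⁻¹ = true} ∩ {ξ | ξ (g⁻¹ * (wd b)⁻¹) = true}
      have hV : ∀ g, IsOpen (V g) := fun g =>
        (isClopen_coord _ _).isOpen.inter (isClopen_coord _ _).isOpen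
      have hcov : Omega X ⊆ ⋃ g, V g := by
        intro ξ hξ
        obtain ⟨η, h1, g, hg, rfl⟩ := mem_closure_iff.1
          (hmin ξ hξ (xi_mem_Omega hyX)) _ (isClopen_coord (wd b)⁻¹ true).isOpen
          ((xiB_true _ _ _).2 ((inv_mem hX hyX b).2 hy))
        exact Set.mem_iUnion.2 ⟨g, hg, h1⟩
      have hcomp : IsCompact (Omega X) := isClosed_closure.isCompact
      obtain ⟨t, ht⟩ := hcomp.elim_finite_subcover V hV hcov
      refine ⟨t.sup fun g => FreeGroup.norm g⁻¹, fun x hx => ?_⟩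
      obtain ⟨g, hgt, hg1, hg2⟩ := Set.mem_iUnion₂.1 (ht (xi_mem_Omega hx))
      obtain ⟨a, c, hp, hl, h⟩ := reach hX hx ((xiB_true _ _ _).1 hg1)
      refine ⟨a, c, hp, h b ((xiB_true _ _ _).1 hg2), ?_⟩
      rw [hl]
      exact Finset.le_sup (f := fun g : FreeGroup Λ => FreeGroup.norm g⁻¹) hgt
  · rintro ⟨h1, h2⟩ ξ hξ
    refine closure_minimal ?_ isClosed_closure
    rintro _ ⟨y, hy, rfl⟩
    refine mem_closure_iff.2 fun U hU hyU => ?_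
    obtain ⟨E, u, hu, hsub⟩ := isOpen_pi_iff.1 hU _ hyU
    obtain ⟨G, hG, hGx⟩ := key hX h1 h2 hy E
    have hcl : IsClosed (⋃ g ∈ G, ({ξ : FreeGroup Λ → Bool | ξ g⁻¹ = true} ∩
        ⋂ h ∈ E, {ξ : FreeGroup Λ → Bool | ξ (g⁻¹ * h) = xiB X y h})) :=
      hG.isClosed_biUnion fun g _ => (isClopen_coord _ _).isClosed.inter
        (isClosed_biInter fun h _ => (isClopen_coord _ _).isClosed)
    have hmem := closure_minimal (s := (fun x => xiB X x) '' X) (by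
      rintro _ ⟨x, hx, rfl⟩
      obtain ⟨g, hg, hgx, hE⟩ := hGx x hx
      refine Set.mem_iUnion₂.2 ⟨g, hg, (xiB_true _ _ _).2 hgx, Set.mem_iInter₂.2 fun h hh => ?_⟩
      show xiB X x (g⁻¹ * h) = xiB X y h
      rw [Bool.eq_iff_iff, xiB_true, xiB_true]
      exact hE h hh) hcl hξ
    obtain ⟨g, hg, hg1, hg2⟩ := Set.mem_iUnion₂.1 hmem
    refine ⟨translate g ξ, hsub fun h hh => ?_, g, hg1, rfl⟩
    have h3 : ξ (g⁻¹ * h) = xiB X y h := Set.mem_iInter₂.1 hg2 h hh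
    show ξ (g⁻¹ * h) ∈ u h
    rw [h3]
    exact (hu h hh).2

end SubshiftPaper
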